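/- arXiv:2605.18670 — 2 statements merged into one kernel-verified Lean document; each statement's English description precedes it below -/
import Mathlib

section
/- In the ballot-discrepancy setting, suppose B is partitioned into nonempty batches B_1,…,B_K with actual sizes n_i := |B_i|, let m_1,…,m_K be positive integers with M = ∑_{i=1}^K m_i (the reported batch sizes, summing to the number of CVR rows), set r_i := m_i/M, let Bad ⊆ {1,…,K}, p := ∑_{i∈Bad} r_i, let 0 ≤ δ ≤ Δ, and assume 1/(1+δ) ≤ n_i/m_i ≤ 1+δ for all i ∉ Bad and 1/(1+Δ) ≤ n_i/m_i ≤ 1+Δ for all i. Let π be the probability distribution on B given by π(b) := r_{i(b)}/n_{i(b)}, where i(b) is the batch containing b, and suppose Δ_T ≥ μ·M for some real μ with 0 ≤ μ ≤ 1. Then ∑_{b∈B} π(b)·D(b) ≥ min{ μ/(1+ε(p)), μ·(1+τ(p)) − τ(p) } − 2κ − 4·Γ_tv(p). -/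
open Finset

/-- The mean absolute deviation of a variable with values in `[1/(1+δ), 1+δ]` is at most
`2δ/(2+δ)` times its mean. -/
lemma sum_mul_abs_sub_mean_le {ι : Type*} [Fintype ι] (r a : ι → ℝ) (δ : ℝ) (hδ : 0 ≤ δ)
    (hr : ∀ i, 0 ≤ r i) (hr1 : ∑ i, r i = 1)
    (ha : ∀ i, 1 / (1 + δ) ≤ a i ∧ a i ≤ 1 + δ) :
    ∑ i, r i * |a i - ∑ j, r j * a j| ≤ 2 * (δ / (2 + δ)) * ∑ j, r j * a j := by
  set A := ∑ j, r j * a j with hA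
  have hc : 0 < 1 + δ := by linarith
  have hAl : 1 / (1 + δ) ≤ A := by
    calc 1 / (1 + δ) = ∑ j, r j * (1 / (1 + δ)) := by rw [← Finset.sum_mul, hr1, one_mul]
      _ ≤ A := Finset.sum_le_sum fun j _ => mul_le_mul_of_nonneg_left (ha j).1 (hr j)
  have hAh : A ≤ 1 + δ := by
    calc A ≤ ∑ j, r j * (1 + δ) :=
          Finset.sum_le_sum fun j _ => mul_le_mul_of_nonneg_left (ha j).2 (hr j)
      _ = 1 + δ := by rw [← Finset.sum_mul, hr1, one_mul]
  rcases hδ.eq_or_lt with h0 | hpos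
  · subst h0
    have hA1 : A = 1 := by norm_num at hAl hAh; linarith
    have ha1 : ∀ i, a i = 1 := fun i => by
      have := ha i
      norm_num at this
      linarith
    simp [ha1, hA1]
  · set l := 1 / (1 + δ) with hl
    have hlc : l * (1 + δ) = 1 := by rw [hl]; field_simp
    have hlt : l < 1 + δ := by
      rw [hl, div_lt_iff₀ hc]; nlinarith
    have key : ∀ i, (1 + δ - l) * (r i * |a i - A|) ≤
        r i * (1 + δ) * (A - l) - r i * a i * (A - l) + r i * a i * (1 + δ - A)
          - r i * l * (1 + δ - A) := fun i => by
      obtain ⟨h1, h2⟩ := ha i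
      have : (1 + δ - l) * |a i - A| ≤ (1 + δ - a i) * (A - l) + (a i - l) * (1 + δ - A) := by
        rcases abs_cases (a i - A) with ⟨h, _⟩ | ⟨h, _⟩ <;> rw [h]
        · nlinarith [mul_nonneg (sub_nonneg.2 h2) (sub_nonneg.2 hAl)]
        · nlinarith [mul_nonneg (sub_nonneg.2 h1) (sub_nonneg.2 hAh)]
      nlinarith [mul_le_mul_of_nonneg_left this (hr i)]
    have hsum := Finset.sum_le_sum fun i (_ : i ∈ Finset.univ) => key i
    simp only [Finset.sum_add_distrib, Finset.sum_sub_distrib, ← Finset.mul_sum,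
      ← Finset.sum_mul, hr1, ← hA] at hsum
    have hid : (1 + δ - l) * (δ / (2 + δ)) = δ - 1 + l := by
      rw [hl]; field_simp; ring
    have hsq : (1 + δ - A) * (A - l) ≤ A * (δ - 1 + l) := by
      nlinarith [sq_nonneg (A - 1)]
    refine le_of_mul_le_mul_left ?_ (sub_pos.2 hlt)
    calc _ ≤ _ := hsum
      _ = 2 * ((1 + δ - A) * (A - l)) := by ring
      _ ≤ 2 * (A * (δ - 1 + l)) := by linarith
      _ = _ := by rw [← hid]; ring

/-- The `ℓ¹` distance between two normalized weight vectors is at most twice the unnormalized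
distance, relative to the total weight of one of them. -/
lemma sum_abs_div_sum_sub_div_sum_le {ι : Type*} [Fintype ι] (w w' : ι → ℝ)
    (hw : ∀ i, 0 ≤ w i) (hW : 0 < ∑ i, w i) (hW' : 0 < ∑ i, w' i) :
    ∑ i, |w' i / (∑ j, w' j) - w i / (∑ j, w j)| ≤
      2 * (∑ i, |w i - w' i|) / (∑ j, w' j) := by
  set W := ∑ j, w j with hWd
  set W' := ∑ j, w' j with hWd'
  have hWW : |W - W'| ≤ ∑ i, |w i - w' i| := by
    rw [hWd, hWd', ← Finset.sum_sub_distrib]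
    exact Finset.abs_sum_le_sum_abs _ _
  have key : ∀ i, |w' i / W' - w i / W| ≤ |w i - w' i| / W' + w i * (|W - W'| / (W * W')) :=
      fun i => by
    have : w' i / W' - w i / W = -((w i - w' i) / W') + w i * ((W - W') / (W * W')) := by
      field_simp; ring
    rw [this]
    refine (abs_add_le _ _).trans (le_of_eq ?_)
    rw [abs_neg, abs_div, abs_mul, abs_div, abs_of_pos hW', abs_of_nonneg (hw i),
      abs_of_pos (mul_pos hW hW')]
  calc _ ≤ ∑ i, (|w i - w' i| / W' + w i * (|W - W'| / (W * W'))) :=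
        Finset.sum_le_sum fun i _ => key i
    _ = (∑ i, |w i - w' i|) / W' + |W - W'| / W' := by
        rw [Finset.sum_add_distrib, ← Finset.sum_div, ← Finset.sum_mul, ← hWd]
        field_simp
    _ ≤ (∑ i, |w i - w' i|) / W' + (∑ i, |w i - w' i|) / W' := by gcongr
    _ = _ := by ring

/-- The `ℓ¹` distance between a probability vector `r` and its reweighting by factors `a` that lie
in `[1/(1+δ), 1+δ]` off `S` and in `[1/(1+Δ), 1+Δ]` on `S`. -/
lemma sum_abs_sub_reweight_le {ι : Type*} [Fintype ι] [DecidableEq ι] (r a : ι → ℝ) (S : Finset ι)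
    (p δ Δ : ℝ) (hδ : 0 ≤ δ) (hδΔ : δ ≤ Δ)
    (hr : ∀ i, 0 ≤ r i) (hr1 : ∑ i, r i = 1) (hp : p = ∑ i ∈ S, r i)
    (hgood : ∀ i ∉ S, 1 / (1 + δ) ≤ a i ∧ a i ≤ 1 + δ)
    (hall : ∀ i, 1 / (1 + Δ) ≤ a i ∧ a i ≤ 1 + Δ) (hA : 0 < ∑ i, r i * a i) :
    ∑ i, |r i - r i * a i / ∑ j, r j * a j| ≤
      2 * (δ / (2 + δ) + (1 + δ) * p * Δ / (1 + δ * p)) := by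
  have hc : 0 < 1 + δ := by linarith
  have hcΔ : 0 < 1 + Δ := by linarith
  have hp0 : 0 ≤ p := hp ▸ Finset.sum_nonneg fun i _ => hr i
  set a' : ι → ℝ := fun i => if i ∈ S then 1 else a i with ha'
  have hl1 : 1 / (1 + δ) ≤ 1 := by rw [div_le_one hc]; linarith
  have ha'b : ∀ i, 1 / (1 + δ) ≤ a' i ∧ a' i ≤ 1 + δ := fun i => by
    by_cases h : i ∈ S
    · simp only [ha', h, if_true]; exact ⟨hl1, by linarith⟩
    · simpa only [ha', h, if_false] using hgood i h
  have hA'l : (1 + δ * p) / (1 + δ) ≤ ∑ i, r i * a' i := by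
    calc (1 + δ * p) / (1 + δ)
        = ∑ i, r i * (1 / (1 + δ)) + ∑ i, (if i ∈ S then r i * (1 - 1 / (1 + δ)) else 0) := by
          rw [Finset.sum_ite_mem, Finset.univ_inter, ← Finset.sum_mul, ← Finset.sum_mul, hr1, ← hp]
          field_simp; ring
      _ ≤ _ := by
          rw [← Finset.sum_add_distrib]
          refine Finset.sum_le_sum fun i _ => ?_
          by_cases h : i ∈ S
          · simp only [ha', h, if_true]; linarith
          · simp only [ha', h, if_false, add_zero]
            exact mul_le_mul_of_nonneg_left (hgood i h).1 (hr i)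
  have hq : 0 < 1 + δ * p := by nlinarith
  have hA' : 0 < ∑ i, r i * a' i := lt_of_lt_of_le (div_pos hq hc) hA'l
  have hfirst : ∑ i, |r i - r i * a' i / ∑ j, r j * a' j| ≤ 2 * (δ / (2 + δ)) := by
    have h := sum_mul_abs_sub_mean_le r a' δ hδ hr hr1 ha'b
    rw [← div_le_iff₀ hA', Finset.sum_div] at h
    refine le_trans (le_of_eq (Finset.sum_congr rfl fun i _ => ?_)) h
    set A' := ∑ j, r j * a' j
    have : r i - r i * a' i / A' = r i * -((a' i - A') / A') := by field_simp; ring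
    rw [this, abs_mul, abs_neg, abs_div, abs_of_nonneg (hr i), abs_of_pos hA', mul_div_assoc]
  have hdiff : ∑ i, |r i * a i - r i * a' i| ≤ p * Δ := by
    calc _ ≤ ∑ i, (if i ∈ S then r i * Δ else 0) := by
          refine Finset.sum_le_sum fun i _ => ?_
          by_cases h : i ∈ S
          · simp only [ha', h, if_true]
            rw [← mul_sub, abs_mul, abs_of_nonneg (hr i)]
            refine mul_le_mul_of_nonneg_left ?_ (hr i)
            have h1 : 1 - Δ ≤ 1 / (1 + Δ) := by
              rw [le_div_iff₀ hcΔ]; nlinarith [sq_nonneg Δ]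
            rw [abs_le]
            constructor <;> linarith [(hall i).1, (hall i).2]
          · simp [ha', h]
      _ = p * Δ := by rw [Finset.sum_ite_mem, Finset.univ_inter, ← Finset.sum_mul, ← hp]
  have hann : ∀ i, 0 ≤ r i * a i := fun i =>
    mul_nonneg (hr i) ((one_div_pos.2 hcΔ).le.trans (hall i).1)
  have hsecond := sum_abs_div_sum_sub_div_sum_le (fun i => r i * a i) (fun i => r i * a' i)
    hann hA hA'
  have hthird : 2 * (∑ i, |r i * a i - r i * a' i|) / (∑ j, r j * a' j) ≤
      2 * ((1 + δ) * p * Δ / (1 + δ * p)) := by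
    calc _ ≤ 2 * (p * Δ) / ((1 + δ * p) / (1 + δ)) := by
          have : 0 ≤ p * Δ := mul_nonneg hp0 (hδ.trans hδΔ)
          gcongr
      _ = _ := by field_simp
  calc _ ≤ ∑ i, (|r i - r i * a' i / ∑ j, r j * a' j| +
        |r i * a' i / (∑ j, r j * a' j) - r i * a i / ∑ j, r j * a j|) :=
        Finset.sum_le_sum fun i _ => abs_sub_le _ _ _
    _ ≤ _ := by
        rw [Finset.sum_add_distrib]
        linarith

/-- The total discrepancy is at least the tabulated total corrected for the number of ballots,
of rows, and of duplicate identifiers. -/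
lemma sum_add_two_mul_card_image_le {B I : Type*} [Fintype B] [DecidableEq I]
    (ident : B → I) (T : Finset I) (v : I → ℤ) (hv : ∀ ι ∈ T, -1 ≤ v ι ∧ v ι ≤ 1) :
    ∑ ι ∈ T, v ι - T.card + 2 * (Finset.univ.image ident).card ≤
      (∑ b, if ident b ∈ T then v (ident b) else 1) + Fintype.card B := by
  set g : I → ℤ := fun ι => if ι ∈ T then v ι else 1 with hg
  have hgl : ∀ ι, 0 ≤ g ι + 1 := fun ι => by
    by_cases h : ι ∈ T
    · simp only [hg, h, if_true]; linarith [(hv ι h).1]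
    · simp [hg, h]
  have himage : ∑ ι ∈ Finset.univ.image ident, (g ι + 1) ≤ ∑ b, (g (ident b) + 1) := by
    rw [Finset.sum_comp (fun ι => g ι + 1) ident]
    refine Finset.sum_le_sum fun ι hι => ?_
    obtain ⟨b, -, hb⟩ := Finset.mem_image.1 hι
    have : 1 ≤ (Finset.univ.filter fun a => ident a = ι).card :=
      Finset.card_pos.2 ⟨b, by simp [hb]⟩
    simpa using nsmul_le_nsmul_left (hgl ι) this
  have hT : ∑ ι ∈ T, (v ι - 1) ≤ ∑ ι ∈ Finset.univ.image ident, (g ι - 1) := by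
    calc ∑ ι ∈ T, (v ι - 1) ≤ ∑ ι ∈ (Finset.univ.image ident) ∩ T, (v ι - 1) :=
          Finset.sum_le_sum_of_subset_of_nonpos' Finset.inter_subset_right
            fun ι h _ => by linarith [(hv ι h).2]
      _ = _ := by
          rw [← Finset.sum_ite_mem]
          refine Finset.sum_congr rfl fun ι _ => ?_
          by_cases h : ι ∈ T <;> simp [hg, h]
  simp only [Finset.sum_add_distrib, Finset.sum_sub_distrib, Finset.sum_const, nsmul_eq_mul,
    mul_one, Finset.card_univ] at himage hT
  change _ ≤ ∑ b, g (ident b) + _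
  linarith

/-- **Ballot-discrepancy lower bound under contaminated reweighting.**
In the ballot-discrepancy setting, suppose the ballots `B` are partitioned into
nonempty batches indexed by `Fin K` (via the surjective batch map `idx`), with
actual sizes `n i` and reported positive sizes `mrep i` summing to `M`.  Set
`r i := mrep i / M`, let `Bad` be a set of batches of tabulated mass
`p := ∑_{i ∈ Bad} r i`, and assume `1/(1+δ) ≤ n i / mrep i ≤ 1+δ` off `Bad`
and `1/(1+Δ) ≤ n i / mrep i ≤ 1+Δ` everywhere, for `0 ≤ δ ≤ Δ`.  Let `π` be
the ballot distribution `π b := r (idx b) / n (idx b)` and suppose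
`Δ_T ≥ μ·M` with `0 ≤ μ ≤ 1`.  Then
`∑_b π(b) D(b) ≥ min { μ/(1+ε(p)), μ(1+τ(p)) − τ(p) } − 2κ − 4Γ_tv(p)`. -/
theorem discrepancy_lower_bound_contaminated_manifest
    {B I : Type*} [Fintype B] [Nonempty B] [DecidableEq I]
    (ident : B → I)
    (marg : B → ℤ) (hmarg : ∀ b, marg b = -1 ∨ marg b = 0 ∨ marg b = 1)
    (T : Finset I)
    (v : I → ℤ) (hv : ∀ ι ∈ T, v ι = -1 ∨ v ι = 0 ∨ v ι = 1)
    (D : B → ℤ)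
    (hD : ∀ b, D b = if ident b ∈ T then v (ident b) - marg b else 1 - marg b)
    (N M : ℕ) (hN : N = Fintype.card B) (hM : M = T.card)
    (κ : ℝ)
    (hκ : κ = ((N : ℝ) - ((Finset.univ.image ident).card : ℝ)) / (N : ℝ))
    (ΔT : ℤ) (hΔT : ΔT = ∑ ι ∈ T, v ι - ∑ b, marg b)
    (K : ℕ) (idx : B → Fin K) (hsurj : Function.Surjective idx)
    (n : Fin K → ℕ)
    (hn : ∀ i, n i = (Finset.univ.filter fun b => idx b = i).card)
    (mrep : Fin K → ℕ) (hmpos : ∀ i, 0 < mrep i) (hMsum : M = ∑ i, mrep i)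
    (r : Fin K → ℝ) (hr : ∀ i, r i = (mrep i : ℝ) / (M : ℝ))
    (Bad : Finset (Fin K)) (p : ℝ) (hp : p = ∑ i ∈ Bad, r i)
    (δ Δ : ℝ) (hδ0 : 0 ≤ δ) (hδΔ : δ ≤ Δ)
    (hgood : ∀ i ∉ Bad,
      1 / (1 + δ) ≤ (n i : ℝ) / (mrep i : ℝ) ∧ (n i : ℝ) / (mrep i : ℝ) ≤ 1 + δ)
    (hall : ∀ i,
      1 / (1 + Δ) ≤ (n i : ℝ) / (mrep i : ℝ) ∧ (n i : ℝ) / (mrep i : ℝ) ≤ 1 + Δ)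
    (π : B → ℝ) (hπ : ∀ b, π b = r (idx b) / (n (idx b) : ℝ))
    (μ : ℝ) (hμ0 : 0 ≤ μ) (hμ1 : μ ≤ 1) (hΔμ : (ΔT : ℝ) ≥ μ * (M : ℝ))
    (ε τ Γ : ℝ)
    (hε : ε = (1 - p) * δ + p * Δ)
    (hτ : τ = ((1 - p) / (1 + δ) + p / (1 + Δ))⁻¹ - 1)
    (hΓ : Γ = δ / (2 + δ) + (1 + δ) * p * Δ / (1 + δ * p)) :
    ∑ b, π b * (D b : ℝ) ≥
      min (μ / (1 + ε)) (μ * (1 + τ) - τ) - 2 * κ - 4 * Γ := by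
  obtain ⟨b₀⟩ := ‹Nonempty B›
  have hM0 : (0 : ℝ) < M := by
    have := Finset.sum_pos (fun i _ => hmpos i) ⟨idx b₀, Finset.mem_univ _⟩
    rw [hMsum]; exact_mod_cast this
  have hN0 : (0 : ℝ) < N := by
    rw [hN]; exact_mod_cast Fintype.card_pos_iff.2 ⟨b₀⟩
  have hNsum : (N : ℝ) = ∑ i, (n i : ℝ) := by
    rw [hN, ← Finset.card_univ, Finset.card_eq_sum_card_fiberwise (f := idx) (t := Finset.univ)
      (fun _ _ => Finset.mem_coe.2 (Finset.mem_univ _))]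
    simp [hn]
  have hn0 : ∀ i, (0 : ℝ) < n i := fun i => by
    obtain ⟨b, hb⟩ := hsurj i
    rw [hn]
    exact_mod_cast Finset.card_pos.2 ⟨b, by simp [hb]⟩
  have hm0 : ∀ i, (0 : ℝ) < mrep i := fun i => by exact_mod_cast hmpos i
  have hr0 : ∀ i, 0 ≤ r i := fun i => by rw [hr]; positivity
  have hr1 : ∑ i, r i = 1 := by
    simp only [hr]
    rw [← Finset.sum_div, div_eq_one_iff_eq hM0.ne', hMsum]
    push_cast; rfl
  have hra : ∀ i, r i * ((n i : ℝ) / mrep i) = n i / M := fun i => by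
    rw [hr]; have := hm0 i; field_simp
  have hA : ∑ i, r i * ((n i : ℝ) / mrep i) = N / M := by
    simp only [hra]; rw [← Finset.sum_div, hNsum]
  have hp0 : 0 ≤ p := hp ▸ Finset.sum_nonneg fun i _ => hr0 i
  have hp1 : p ≤ 1 := by
    rw [hp, ← hr1]
    exact Finset.sum_le_sum_of_subset_of_nonneg (Finset.subset_univ _) fun i _ _ => hr0 i
  -- distance between `π` and the uniform distribution
  have hreweight := sum_abs_sub_reweight_le r (fun i => (n i : ℝ) / mrep i) Bad p δ Δ hδ0 hδΔ
    hr0 hr1 hp hgood hall (by rw [hA]; positivity)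
  rw [← hΓ] at hreweight
  have htv : ∑ b, |π b - 1 / N| ≤ 2 * Γ := by
    refine le_trans (le_of_eq ?_) hreweight
    rw [← Finset.sum_fiberwise Finset.univ idx]
    refine Finset.sum_congr rfl fun i _ => ?_
    have hconst : ∀ b ∈ Finset.univ.filter (fun b => idx b = i),
        |π b - 1 / N| = |r i / n i - 1 / N| := fun b hb => by
      rw [hπ, (Finset.mem_filter.1 hb).2]
    rw [Finset.sum_congr rfl hconst, Finset.sum_const, ← hn, nsmul_eq_mul,
      hA, hra, ← abs_of_pos (hn0 i), ← abs_mul, abs_of_pos (hn0 i)]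
    congr 1
    have := hn0 i
    field_simp
  have hDb : ∀ b, |(D b : ℝ)| ≤ 2 := fun b => by
    have : |D b| ≤ 2 := by
      rw [hD, abs_le]
      split_ifs with h
      · rcases hmarg b with h1 | h1 | h1 <;> rcases hv _ h with h2 | h2 | h2 <;> omega
      · rcases hmarg b with h1 | h1 | h1 <;> omega
    exact_mod_cast this
  have hshift : (∑ b, (D b : ℝ)) / N - 4 * Γ ≤ ∑ b, π b * (D b : ℝ) := by
    have h1 : (∑ b, (D b : ℝ)) / N - ∑ b, π b * (D b : ℝ) ≤ ∑ b, |π b - 1 / N| * 2 := by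
      rw [Finset.sum_div, ← Finset.sum_sub_distrib]
      refine Finset.sum_le_sum fun b _ => ?_
      calc (D b : ℝ) / N - π b * D b = -((π b - 1 / N) * D b) := by ring
        _ ≤ |(π b - 1 / N) * D b| := neg_le_abs _
        _ ≤ _ := by
          rw [abs_mul]; exact mul_le_mul_of_nonneg_left (hDb b) (abs_nonneg _)
    rw [← Finset.sum_mul] at h1
    linarith
  -- average discrepancy under the uniform distribution
  have hcount := sum_add_two_mul_card_image_le ident T v fun ι h => by
    rcases hv ι h with h | h | h <;> omega
  have hDsum : (∑ b, if ident b ∈ T then v (ident b) else 1) = ∑ b, D b + ∑ b, marg b := by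
    rw [← Finset.sum_add_distrib]
    refine Finset.sum_congr rfl fun b _ => ?_
    rw [hD]; split_ifs <;> ring
  have hunif : (ΔT : ℝ) - M + 2 * ((Finset.univ.image ident).card : ℝ) ≤
      ∑ b, (D b : ℝ) + N := by
    rw [hDsum, ← hM, ← hN] at hcount
    have : ΔT - M + 2 * ((Finset.univ.image ident).card : ℤ) ≤ ∑ b, D b + N := by
      rw [hΔT]; linarith
    exact_mod_cast this
  have havg : 1 - (1 - μ) * (M / N) - 2 * κ ≤ (∑ b, (D b : ℝ)) / N := by
    rw [le_div_iff₀ hN0, hκ]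
    have : (1 - (1 - μ) * ((M : ℝ) / N) -
        2 * (((N : ℝ) - ((Finset.univ.image ident).card : ℝ)) / N)) * N =
        N - (1 - μ) * M - 2 * (N - ((Finset.univ.image ident).card : ℝ)) := by
      field_simp
    rw [this]
    linarith
  -- the size ratio
  have hc : 0 < 1 + δ := by linarith
  have hcΔ : 0 < 1 + Δ := by linarith
  have hratio : (1 - p) / (1 + δ) + p / (1 + Δ) ≤ N / M := by
    have hcompl : 1 - p = ∑ i ∈ Badᶜ, r i := by
      rw [← hr1, hp, ← Finset.sum_add_sum_compl Bad r, add_sub_cancel_left]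
    rw [← hA, ← Finset.sum_add_sum_compl Bad, add_comm]
    refine add_le_add ?_ ?_
    · rw [hp, div_eq_mul_one_div, Finset.sum_mul]
      exact Finset.sum_le_sum fun i _ => mul_le_mul_of_nonneg_left (hall i).1 (hr0 i)
    · rw [hcompl, div_eq_mul_one_div, Finset.sum_mul]
      exact Finset.sum_le_sum fun i hi =>
        mul_le_mul_of_nonneg_left (hgood i (Finset.mem_compl.1 hi)).1 (hr0 i)
  have hden : 0 < (1 - p) / (1 + δ) + p / (1 + Δ) := by
    rcases hp0.eq_or_lt with h | h
    · rw [← h]; simpa using hc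
    · exact add_pos_of_nonneg_of_pos (div_nonneg (by linarith) hc.le) (div_pos h hcΔ)
  have hτM : (M : ℝ) / N ≤ 1 + τ := by
    have := inv_anti₀ hden hratio
    rw [inv_div] at this
    linarith
  have hμτ : μ * (1 + τ) - τ ≤ 1 - (1 - μ) * (M / N) := by
    nlinarith [mul_le_mul_of_nonneg_left hτM (sub_nonneg.2 hμ1)]
  linarith [min_le_right (μ / (1 + ε)) (μ * (1 + τ) - τ)]
end

section
/- Let A be a finite set with |A| = n ≥ 1, let f : A → B be a function into a finite set B with |B| = n − ℓ for an integer ℓ ≥ 0, let c ≥ 0, and let Π be a probability distribution on A with 1/(n(1+c)) ≤ Π(x) ≤ (1+c)/n for all x ∈ A. Let Y_1,…,Y_k be independent random variables each distributed according to Π, and let E_k^iid be the event that for all i ≠ j in {1,…,k}, f(Y_i) = f(Y_j) implies Y_i = Y_j. If k ≤ n(1+c), then Pr[E_k^iid] ≤ 2·exp(−ℓ·(1 − exp(−k/(n(1+c))))²), and this quantity is at most 2·exp(−k²·ℓ/(4·n²·(1+c)²)). -/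
open Finset

/-! ### The median of the Poisson distribution -/

/-- For `0 ≤ u`, the reflection inequality `(1 - u) eᵘ ≤ (1 + u) e⁻ᵘ`. -/
lemma one_sub_mul_exp_le {u : ℝ} (hu : 0 ≤ u) :
    (1 - u) * Real.exp u ≤ (1 + u) * Real.exp (-u) := by
  have hd : ∀ x : ℝ, HasDerivAt (fun x : ℝ => (1 + x) * Real.exp (-x) - (1 - x) * Real.exp x)
      (x * (Real.exp x - Real.exp (-x))) x := by
    intro x
    have h1 := ((hasDerivAt_id x).const_add 1).mul (hasDerivAt_id x).neg.exp
    have h2 := ((hasDerivAt_id x).const_sub 1).mul (hasDerivAt_id x).exp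
    refine (h1.sub h2).congr_deriv ?_
    simp only [id, Pi.neg_apply]
    ring
  have hm : MonotoneOn (fun x : ℝ => (1 + x) * Real.exp (-x) - (1 - x) * Real.exp x)
      (Set.Ici 0) := by
    refine monotoneOn_of_deriv_nonneg (convex_Ici 0)
      (fun x _ => (hd x).continuousAt.continuousWithinAt)
      (fun x _ => (hd x).differentiableAt.differentiableWithinAt) fun x hx => ?_
    rw [interior_Ici, Set.mem_Ioi] at hx
    rw [(hd x).deriv]
    exact mul_nonneg hx.le (sub_nonneg.2 (Real.exp_le_exp.2 (by linarith)))
  have h := hm (Set.mem_Ici.2 le_rfl) (Set.mem_Ici.2 hu) hu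
  simp at h
  linarith

lemma hasDerivAt_exp_neg_mul_sum_pow_div_factorial (k : ℕ) (t : ℝ) :
    HasDerivAt (fun t : ℝ => Real.exp (-t) * ∑ j ∈ range (k + 1), t ^ j / (j.factorial : ℝ))
      (-(Real.exp (-t) * (t ^ k / (k.factorial : ℝ)))) t := by
  have hS : HasDerivAt (fun t : ℝ => ∑ j ∈ range (k + 1), t ^ j / (j.factorial : ℝ))
      (∑ j ∈ range k, t ^ j / (j.factorial : ℝ)) t := by
    induction k with
    | zero => simpa using hasDerivAt_const t (1 : ℝ)
    | succ k ih =>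
      have h := ih.add ((hasDerivAt_pow (k + 1) t).div_const ((k + 1).factorial : ℝ))
      simp only [sum_range_succ _ (k + 1)]
      rw [sum_range_succ]
      refine h.congr_deriv ?_
      rw [Nat.factorial_succ]
      push_cast
      field_simp
  have h := (hasDerivAt_id t).neg.exp.mul hS
  refine h.congr_deriv ?_
  rw [sum_range_succ]
  simp only [id, Pi.neg_apply]
  ring

lemma sub_pow_mul_exp_le (k : ℕ) {s : ℝ} (hs : 0 ≤ s) (hsk : s ≤ k) :
    Real.exp (-(k - s)) * (k - s) ^ k ≤ Real.exp (-(k + s)) * (k + s) ^ k := by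
  rcases k.eq_zero_or_pos with rfl | hk
  · have : s = 0 := le_antisymm (by simpa using hsk) hs
    simp [this]
  have hk' : (0 : ℝ) < k := by exact_mod_cast hk
  have hle : s / k ≤ 1 := (div_le_one hk').2 hsk
  have h := pow_le_pow_left₀ (mul_nonneg (by linarith) (Real.exp_pos _).le)
    (one_sub_mul_exp_le (div_nonneg hs hk'.le)) k
  rw [mul_pow, mul_pow, ← Real.exp_nat_mul, ← Real.exp_nat_mul] at h
  have e1 : (k : ℝ) * (s / k) = s := by field_simp
  have e2 : (k : ℝ) * (-(s / k)) = -s := by field_simp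
  have e3 : (k : ℝ) - s = k * (1 - s / k) := by field_simp
  have e4 : (k : ℝ) + s = k * (1 + s / k) := by field_simp
  rw [e1, e2] at h
  rw [show -((k : ℝ) - s) = -k + s by ring, show -((k : ℝ) + s) = -k + -s by ring,
    Real.exp_add, Real.exp_add, e3, e4, mul_pow, mul_pow]
  calc _ = Real.exp (-k) * (k : ℝ) ^ k * ((1 - s / k) ^ k * Real.exp s) := by ring
    _ ≤ Real.exp (-k) * (k : ℝ) ^ k * ((1 + s / k) ^ k * Real.exp (-s)) := by gcongr
    _ = _ := by ring

/-- A Poisson variable with integer parameter `k` is at most `k` with probability at least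
one half. -/
lemma exp_le_two_mul_sum_pow_div_factorial (k : ℕ) :
    Real.exp k ≤ 2 * ∑ j ∈ range (k + 1), (k : ℝ) ^ j / (j.factorial : ℝ) := by
  set F : ℝ → ℝ := fun t => Real.exp (-t) * ∑ j ∈ range (k + 1), t ^ j / (j.factorial : ℝ)
    with hF
  have hd : ∀ s : ℝ, HasDerivAt (fun s => F (k + s) + F (k - s))
      (-(Real.exp (-(k + s)) * ((k + s) ^ k / (k.factorial : ℝ))) +
        Real.exp (-(k - s)) * ((k - s) ^ k / (k.factorial : ℝ))) s := by
    intro s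
    have h1 := (hasDerivAt_exp_neg_mul_sum_pow_div_factorial k (k + s)).comp_const_add (k : ℝ) s
    have h2 := (hasDerivAt_exp_neg_mul_sum_pow_div_factorial k (k - s)).comp_const_sub (k : ℝ) s
    exact (h1.add h2).congr_deriv (by ring)
  have hm : AntitoneOn (fun s => F (k + s) + F (k - s)) (Set.Icc 0 k) := by
    refine antitoneOn_of_deriv_nonpos (convex_Icc 0 _)
      (fun x _ => (hd x).continuousAt.continuousWithinAt)
      (fun x _ => (hd x).differentiableAt.differentiableWithinAt) fun x hx => ?_
    rw [interior_Icc, Set.mem_Ioo] at hx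
    rw [(hd x).deriv, ← mul_div_assoc, ← mul_div_assoc, neg_add_nonpos_iff]
    exact div_le_div_of_nonneg_right (sub_pow_mul_exp_le k hx.1.le hx.2.le) (by positivity)
  have hk : (0 : ℝ) ≤ k := k.cast_nonneg
  have h := hm (Set.left_mem_Icc.2 hk) (Set.right_mem_Icc.2 hk) hk
  have hF0 : F 0 = 1 := by simp [hF, sum_range_succ']
  have hF2 : 0 ≤ F (k + k) := by simp only [hF]; positivity
  simp only [add_zero, sub_zero, sub_self, hF0] at h
  have hFk : 1 ≤ 2 * F k := by linarith
  calc Real.exp k = Real.exp k * 1 := (mul_one _).symm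
    _ ≤ Real.exp k * (2 * F k) := by gcongr
    _ = 2 * (Real.exp k * Real.exp (-k)) * ∑ j ∈ range (k + 1), (k : ℝ) ^ j / (j.factorial : ℝ) := by
        simp only [hF]; ring
    _ = _ := by rw [← Real.exp_add]; simp

/-! ### Exponential generating functions of weighted words -/

/-- The exponential generating function of weighted words whose set of letters is exactly `S`. -/
lemma hasSum_words_image_eq {A : Type*} [Fintype A] [DecidableEq A] (p : A → ℝ) (r : ℝ)
    (S : Finset A) :
    HasSum (fun j : ℕ => r ^ j / (j.factorial : ℝ) *
        ∑ y : Fin j → A with univ.image y = S, ∏ t, p (y t))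
      (∏ x ∈ S, (Real.exp (r * p x) - 1)) := by
  induction S using Finset.strongInduction with
  | H S ih =>
    have hexp : HasSum (fun j : ℕ => (r * ∑ x ∈ S, p x) ^ j / (j.factorial : ℝ))
        (Real.exp (r * ∑ x ∈ S, p x)) := by
      rw [Real.exp_eq_exp_ℝ]
      exact NormedSpace.expSeries_div_hasSum_exp _
    have hprop := hexp.sub (hasSum_sum (s := S.ssubsets) fun T hT => ih T (mem_ssubsets.1 hT))
    have hsplit : ∀ v : Finset A → ℝ, ∑ T ∈ S.powerset, v T = v S + ∑ T ∈ S.ssubsets, v T :=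
      fun v => by rw [ssubsets, add_sum_erase _ _ (mem_powerset_self S)]
    have he : Real.exp (r * ∑ x ∈ S, p x) =
        ∑ T ∈ S.powerset, ∏ x ∈ T, (Real.exp (r * p x) - 1) := by
      rw [mul_sum, Real.exp_sum, ← prod_one_add]
      exact prod_congr rfl fun x _ => by ring
    rw [he, hsplit, add_sub_cancel_right] at hprop
    refine (congrArg (fun g : ℕ → ℝ => HasSum g _) (funext fun j => ?_)).mpr hprop
    · have hw : (∑ x ∈ S, p x) ^ j =
          ∑ T ∈ S.powerset, ∑ y : Fin j → A with univ.image y = T, ∏ t, p (y t) := by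
        rw [sum_pow', ← sum_fiberwise_of_maps_to (t := S.powerset) (g := fun y => univ.image y)]
        · refine sum_congr rfl fun T hT => sum_congr ?_ fun _ _ => rfl
          ext y
          simp only [mem_filter, Fintype.mem_piFinset, mem_univ, true_and, and_iff_right_iff_imp]
          rintro rfl t
          exact mem_powerset.1 hT (mem_image_of_mem _ (mem_univ t))
        · intro y hy
          rw [mem_powerset, image_subset_iff]
          exact fun t _ => Fintype.mem_piFinset.1 hy t
      rw [mul_pow, mul_div_right_comm, hw, hsplit, mul_add, mul_sum S.ssubsets, add_sub_cancel_right]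

/-- Expansion over partial transversals of the fibres of `f`. -/
lemma sum_injOn_prod_eq {A B : Type*} [Fintype A] [DecidableEq A] [Fintype B] [DecidableEq B]
    (f : A → B) (u : A → ℝ) [DecidablePred fun S : Finset A => Set.InjOn f S] :
    ∑ S ∈ univ.filter fun S : Finset A => Set.InjOn f S, ∏ x ∈ S, u x =
      ∏ b, (1 + ∑ x with f x = b, u x) := by
  have hfib : ∀ b, 1 + ∑ x with f x = b, u x =
      ∑ T ∈ (univ.filter (f · = b)).powerset with #T ≤ 1, ∏ x ∈ T, u x := by
    intro b
    have : (univ.filter (f · = b)).powerset.filter (#· ≤ 1) =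
        insert ∅ ((univ.filter (f · = b)).image singleton) := by
      ext T
      simp only [mem_filter, mem_powerset, mem_insert, mem_image, mem_univ, true_and]
      constructor
      · rintro ⟨h1, h2⟩
        rcases T.eq_empty_or_nonempty with rfl | ⟨x, hx⟩
        · exact .inl rfl
        · refine .inr ⟨x, (mem_filter.1 (h1 hx)).2, ?_⟩
          exact (eq_singleton_iff_unique_mem.2
            ⟨hx, fun y hy => card_le_one.1 h2 y hy x hx⟩).symm
      · rintro (rfl | ⟨x, hx, rfl⟩)
        · simp
        · simp [hx]
    rw [this, sum_insert (by simp), sum_image (fun x _ y _ h => singleton_injective h)]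
    simp
  rw [prod_congr rfl fun b _ => hfib b, prod_univ_sum]
  refine sum_nbij' (fun S b => S.filter (f · = b)) (fun h => univ.biUnion h) ?_ ?_ ?_ ?_ ?_
  · intro S hS
    have hS := (mem_filter.1 hS).2
    simp only [Fintype.mem_piFinset, mem_filter, mem_powerset]
    refine fun b => ⟨filter_subset_filter _ (subset_univ _), card_le_one.2 fun x hx y hy => ?_⟩
    rw [mem_filter] at hx hy
    exact hS hx.1 hy.1 (hx.2.trans hy.2.symm)
  · intro h hh
    simp only [Fintype.mem_piFinset, mem_filter, mem_powerset] at hh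
    have hf : ∀ b, ∀ x ∈ h b, f x = b := fun b x hx => (mem_filter.1 ((hh b).1 hx)).2
    refine mem_filter.2 ⟨mem_univ _, fun x hx y hy hxy => ?_⟩
    simp only [coe_biUnion, Set.mem_iUnion, mem_coe] at hx hy
    obtain ⟨b, -, hx⟩ := hx
    obtain ⟨b', -, hy⟩ := hy
    obtain rfl : b = b' := by rw [← hf b x hx, ← hf b' y hy, hxy]
    exact card_le_one.1 (hh b).2 x hx y hy
  · intro S _
    ext x
    simp
  · intro h hh
    simp only [Fintype.mem_piFinset, mem_filter, mem_powerset] at hh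
    have hf : ∀ b, ∀ x ∈ h b, f x = b := fun b x hx => (mem_filter.1 ((hh b).1 hx)).2
    funext b
    ext x
    simp only [mem_filter, mem_biUnion, mem_univ, true_and]
    constructor
    · rintro ⟨⟨b', hx⟩, rfl⟩
      rwa [hf b' x hx]
    · exact fun hx => ⟨⟨b, hx⟩, hf b x hx⟩
  · exact fun S _ => (prod_fiberwise S f u).symm

/-- The probability that a fibre is hit at most once, in Poissonized form. -/
lemma one_add_sum_le_prod_mul_exp {A : Type*} [DecidableEq A] (e : A → ℝ) {q : ℝ} (hq : 0 ≤ q)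
    (he : ∀ x, 1 ≤ e x * (1 - q)) (he1 : ∀ x, 1 ≤ e x) (s : Finset A) :
    1 + ∑ x ∈ s, (e x - 1) ≤ (∏ x ∈ s, e x) * Real.exp (-((#s : ℝ) - 1) * q ^ 2) := by
  rcases s.eq_empty_or_nonempty with rfl | hs
  · simpa using sq_nonneg q
  induction hs using Finset.Nonempty.cons_induction with
  | singleton a => simp
  | cons a s ha hs ih =>
    set H := 1 + ∑ x ∈ s, (e x - 1) with hH
    obtain ⟨b, hb⟩ := hs
    have hHb : e b ≤ H := by
      have := single_le_sum (f := fun x => e x - 1) (fun x _ => sub_nonneg.2 (he1 x)) hb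
      linarith
    have hq1 : 0 < 1 - q := by
      by_contra! h
      nlinarith [he a, he1 a]
    have hHq : 1 ≤ H * (1 - q) := (he b).trans (by gcongr)
    have hH0 : 0 < H := by linarith [he1 b]
    have ha0 : 0 < e a := by linarith [he1 a]
    have hstep : H + (e a - 1) ≤ H * e a * Real.exp (-q ^ 2) := by
      have h1 : 1 - q ^ 2 ≤ Real.exp (-q ^ 2) := by linarith [Real.add_one_le_exp (-q ^ 2)]
      have h2 : H * e a * (1 - q ^ 2) ≤ H * e a * Real.exp (-q ^ 2) := by gcongr
      have h3 : (H * q) * (e a * q) ≤ (H - 1) * (e a - 1) :=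
        mul_le_mul (by linarith) (by linarith [he a]) (by positivity) (by linarith [he1 b])
      nlinarith
    rw [sum_cons, prod_cons, card_cons]
    calc 1 + (e a - 1 + ∑ x ∈ s, (e x - 1)) = H + (e a - 1) := by rw [hH]; ring
      _ ≤ H * (e a * Real.exp (-q ^ 2)) := by linarith
      _ ≤ ((∏ x ∈ s, e x) * Real.exp (-((#s : ℝ) - 1) * q ^ 2)) * (e a * Real.exp (-q ^ 2)) := by
          gcongr
      _ = e a * (∏ x ∈ s, e x) * (Real.exp (-((#s : ℝ) - 1) * q ^ 2) * Real.exp (-q ^ 2)) := by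
          ring
      _ = _ := by
          rw [← Real.exp_add]
          push_cast
          congr 2
          ring

/-! ### The no-collision event -/

/-- The no-collision probability does not increase with the number of samples. -/
lemma antitone_sum_no_collision {A B : Type*} [Fintype A] [DecidableEq A] [DecidableEq B]
    (f : A → B) (p : A → ℝ) (hp0 : ∀ x, 0 ≤ p x) (hp1 : ∑ x, p x = 1) :
    Antitone fun k : ℕ => ∑ y : Fin k → A with
      ∀ i j : Fin k, i ≠ j → f (y i) = f (y j) → y i = y j, ∏ t, p (y t) := by
  refine antitone_nat_of_succ_le fun k => ?_
  simp only [sum_filter]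
  rw [← (Fin.consEquiv fun _ : Fin (k + 1) => A).sum_comp, Fintype.sum_prod_type]
  calc _ ≤ ∑ x, ∑ y : Fin k → A, p x *
        (if ∀ i j : Fin k, i ≠ j → f (y i) = f (y j) → y i = y j then ∏ t, p (y t) else 0) := by
        refine sum_le_sum fun x _ => sum_le_sum fun y _ => ?_
        have hnn : 0 ≤ ∏ t, p (y t) := prod_nonneg fun t _ => hp0 _
        split_ifs with h1 h2 h2
        · simp [Fin.consEquiv, Fin.prod_univ_succ]
        · refine absurd (fun i j hij hf => ?_) h2
          have := h1 i.succ j.succ (by simpa using hij)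
          simp only [Fin.consEquiv, Equiv.coe_fn_mk, Fin.cons_succ] at this
          exact this hf
        · exact mul_nonneg (hp0 x) hnn
        · simp
    _ = _ := by rw [← sum_mul_sum, hp1, one_mul]

/-- Poissonization: the exponential generating function of the no-collision probabilities. -/
lemma hasSum_no_collision {A B : Type*} [Fintype A] [DecidableEq A] [Fintype B] [DecidableEq B]
    (f : A → B) (p : A → ℝ) (r : ℝ) :
    HasSum (fun k : ℕ => r ^ k / (k.factorial : ℝ) * ∑ y : Fin k → A with
        ∀ i j : Fin k, i ≠ j → f (y i) = f (y j) → y i = y j, ∏ t, p (y t))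
      (∏ b, (1 + ∑ x with f x = b, (Real.exp (r * p x) - 1))) := by
  classical
  rw [← sum_injOn_prod_eq f]
  refine (congrArg (fun g : ℕ → ℝ => HasSum g _) (funext fun k => ?_)).mpr
    (hasSum_sum (s := univ.filter fun S : Finset A => Set.InjOn f S)
      fun S _ => hasSum_words_image_eq p r S)
  rw [← mul_sum]
  congr 1
  rw [← sum_fiberwise_of_maps_to (t := univ.filter fun S : Finset A => Set.InjOn f S)
    (g := fun y : Fin k → A => univ.image y)]
  · refine sum_congr rfl fun S hS => sum_congr ?_ fun _ _ => rfl
    ext y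
    simp only [mem_filter, mem_univ, true_and, and_iff_right_iff_imp]
    rintro rfl i j - hf
    exact (mem_filter.1 hS).2 (by simp) (by simp) hf
  · intro y hy
    refine mem_filter.2 ⟨mem_univ _, ?_⟩
    simp only [coe_image, coe_univ, Set.image_univ]
    rintro _ ⟨i, rfl⟩ _ ⟨j, rfl⟩ hf
    by_cases hij : i = j
    · rw [hij]
    · exact (mem_filter.1 hy).2 i j hij hf

lemma half_le_one_sub_exp_neg {t : ℝ} (h0 : 0 ≤ t) (h1 : t ≤ 1) :
    t / 2 ≤ 1 - Real.exp (-t) := by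
  have h : Real.exp (-t) * (1 + t) ≤ 1 := by
    calc Real.exp (-t) * (1 + t) ≤ Real.exp (-t) * Real.exp t := by
          gcongr
          linarith [Real.add_one_le_exp t]
      _ = 1 := by rw [← Real.exp_add]; simp
  nlinarith [mul_nonneg h0 (sub_nonneg.2 h1)]

/-- **Simple duplicate-detection bound under i.i.d. sampling.**
Let `A` be a finite set of size `n ≥ 1`, `f : A → B` a map into a finite set of
size `n − ℓ`, `c ≥ 0`, and `Π` a probability distribution on `A` with
`1/(n(1+c)) ≤ Pdist(x) ≤ (1+c)/n` for all `x`.  For `Y₁,…,Y_k` i.i.d. with law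
`Π`, the probability of the no-collision event
`E_k^iid = {∀ i ≠ j, f(Y_i) = f(Y_j) → Y_i = Y_j}` — written here as the sum,
over all tuples `y : Fin k → A` satisfying the condition, of `∏ t, Pdist (y t)` —
is at most `2·exp(−ℓ(1 − exp(−k/(n(1+c))))²)`, which in turn is at most
`2·exp(−k²ℓ/(4n²(1+c)²))`, provided `k ≤ n(1+c)`. -/
theorem duplicate_detection_iid
    {A B : Type*} [Fintype A] [DecidableEq A] [Fintype B] [DecidableEq B]
    (f : A → B)
    (n ℓ : ℕ) (hn : Fintype.card A = n) (hn1 : 1 ≤ n)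
    (hℓn : ℓ ≤ n) (hB : Fintype.card B = n - ℓ)
    (c : ℝ) (hc : 0 ≤ c)
    (Pdist : A → ℝ) (hPdist0 : ∀ x, 0 ≤ Pdist x) (hPdist1 : ∑ x, Pdist x = 1)
    (hPdistlb : ∀ x, 1 / ((n : ℝ) * (1 + c)) ≤ Pdist x)
    (hPdistub : ∀ x, Pdist x ≤ (1 + c) / (n : ℝ))
    (k : ℕ) (hk : (k : ℝ) ≤ (n : ℝ) * (1 + c)) :
    (∑ y ∈ (Finset.univ.filter fun y : Fin k → A =>
        ∀ i j : Fin k, i ≠ j → f (y i) = f (y j) → y i = y j),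
        ∏ t, Pdist (y t)) ≤
      2 * Real.exp (-(ℓ : ℝ) *
        (1 - Real.exp (-(k : ℝ) / ((n : ℝ) * (1 + c)))) ^ 2) ∧
    2 * Real.exp (-(ℓ : ℝ) *
        (1 - Real.exp (-(k : ℝ) / ((n : ℝ) * (1 + c)))) ^ 2) ≤
      2 * Real.exp (-((k : ℝ) ^ 2 * (ℓ : ℝ)) /
        (4 * (n : ℝ) ^ 2 * (1 + c) ^ 2)) := by
  have hn0 : (0 : ℝ) < n := by exact_mod_cast hn1
  have hN : 0 < (n : ℝ) * (1 + c) := by positivity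
  have hk0 : (0 : ℝ) ≤ k := k.cast_nonneg
  have ht0 : 0 ≤ (k : ℝ) / (n * (1 + c)) := by positivity
  have ht1 : (k : ℝ) / (n * (1 + c)) ≤ 1 := (div_le_one hN).2 hk
  rw [neg_div]
  set μ := (k : ℝ) / (n * (1 + c)) with hμ
  set q := 1 - Real.exp (-μ) with hq
  have hhalf : μ / 2 ≤ q := half_le_one_sub_exp_neg ht0 ht1
  have hq0 : 0 ≤ q := by linarith
  constructor
  · set a : ℕ → ℝ := fun k => ∑ y : Fin k → A with
      ∀ i j : Fin k, i ≠ j → f (y i) = f (y j) → y i = y j, ∏ t, Pdist (y t) with ha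
    have ha0 : ∀ j, 0 ≤ a j := fun j => sum_nonneg fun y _ => prod_nonneg fun t _ => hPdist0 _
    have hanti : Antitone a := antitone_sum_no_collision f Pdist hPdist0 hPdist1
    have hpoisson : a k * ∑ j ∈ range (k + 1), (k : ℝ) ^ j / (j.factorial : ℝ) ≤
        ∏ b, (1 + ∑ x with f x = b, (Real.exp (k * Pdist x) - 1)) := by
      refine le_trans ?_ (sum_le_hasSum (range (k + 1))
        (fun j _ => mul_nonneg (by positivity) (ha0 j)) (hasSum_no_collision f Pdist k))
      rw [mul_sum]
      refine sum_le_sum fun j hj => ?_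
      rw [mul_comm]
      exact mul_le_mul_of_nonneg_left (hanti (Nat.lt_succ_iff.1 (mem_range.1 hj)))
        (by positivity)
    have hprod : ∏ b, (1 + ∑ x with f x = b, (Real.exp (k * Pdist x) - 1)) ≤
        Real.exp k * Real.exp (-(ℓ : ℝ) * q ^ 2) := by
      have hμle : ∀ x, μ ≤ k * Pdist x := fun x => by
        have := mul_le_mul_of_nonneg_left (hPdistlb x) hk0
        rwa [mul_one_div] at this
      have hcard : ∑ b : B, ((#{x | f x = b} : ℝ) - 1) = ℓ := by
        have h := card_eq_sum_card_fiberwise (f := f) (s := univ) (t := univ) (by simp)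
        rw [card_univ, hn] at h
        rw [sum_sub_distrib, ← Nat.cast_sum, ← h, sum_const, card_univ, hB, nsmul_eq_mul,
          Nat.cast_sub hℓn]
        ring
      calc _ ≤ ∏ b, ((∏ x with f x = b, Real.exp (k * Pdist x)) *
            Real.exp (-((#{x | f x = b} : ℝ) - 1) * q ^ 2)) := by
            refine prod_le_prod (fun b _ => ?_) fun b _ =>
              one_add_sum_le_prod_mul_exp _ hq0 (fun x => ?_) (fun x => ?_) _
            · refine add_nonneg zero_le_one (sum_nonneg fun x _ => sub_nonneg.2 ?_)
              exact Real.one_le_exp (mul_nonneg hk0 (hPdist0 x))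
            · rw [hq, sub_sub_cancel, ← Real.exp_add]
              exact Real.one_le_exp (by linarith [hμle x])
            · exact Real.one_le_exp (mul_nonneg hk0 (hPdist0 x))
        _ = _ := by
            rw [prod_mul_distrib, prod_fiberwise, ← Real.exp_sum, ← Real.exp_sum, ← mul_sum,
              hPdist1, mul_one, ← sum_mul, sum_neg_distrib, hcard]
    have hmed := mul_le_mul_of_nonneg_left (exp_le_two_mul_sum_pow_div_factorial k) (ha0 k)
    refine le_of_mul_le_mul_right ?_ (Real.exp_pos (k : ℝ))
    change a k * Real.exp k ≤ _
    linarith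
  · gcongr
    have hsq : (μ / 2) ^ 2 ≤ q ^ 2 := pow_le_pow_left₀ (by positivity) hhalf 2
    have he : -((k : ℝ) ^ 2 * ℓ) / (4 * (n : ℝ) ^ 2 * (1 + c) ^ 2) = -(ℓ : ℝ) * (μ / 2) ^ 2 := by
      rw [hμ]
      field_simp
      ring
    rw [he]
    exact mul_le_mul_of_nonpos_left hsq (by simp)
end
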